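/- Let (C, S, N, f) be an automaton with f commutative, and let η be an asynchronous trajectory. Then the synchronous trajectory with initial configuration η(·,0) dominates η. -/

import Mathlib

namespace AsyncUpdating

variable {C S : Type*}

/-- `f` is a transition function for the neighborhood function `N`:
`f ξ x` depends only on the restriction of `ξ` to `N x`. -/
def IsTransition (N : C → Set C) (f : (C → S) → C → S) : Prop :=
  ∀ (ξ₁ ξ₂ : C → S) (x : C), (∀ y ∈ N x, ξ₁ y = ξ₂ y) → f ξ₁ x = f ξ₂ x

/-- The automaton is local: every neighborhood is finite. -/
def IsLocal (N : C → Set C) : Prop := ∀ x, (N x).Finite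

open Classical in
/-- `upd f ξ E` is the configuration `f(ξ, E)`: apply `f` at the sites of `E` only. -/
noncomputable def upd (f : (C → S) → C → S) (ξ : C → S) (E : Set C) : C → S :=
  fun x => if x ∈ E then f ξ x else ξ x

/-- The set `L(ξ)` of free sites. -/
def freeSet (f : (C → S) → C → S) (ξ : C → S) : Set C := {x | f ξ x ≠ ξ x}

/-- `η` is an asynchronous trajectory of `f`. -/
def IsAsyncTraj (f : (C → S) → C → S) (η : C → ℕ → S) : Prop :=
  ∀ x t, η x (t + 1) ≠ η x t → η x (t + 1) = f (fun y => η y t) x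

/-- `η` is a synchronous trajectory of `f`. -/
def IsSyncTraj (f : (C → S) → C → S) (η : C → ℕ → S) : Prop :=
  ∀ x t, η x (t + 1) = f (fun y => η y t) x

/-- The synchronous trajectory of `f` with initial configuration `ξ`. -/
def syncTraj (f : (C → S) → C → S) (ξ : C → S) : ℕ → C → S
  | 0 => ξ
  | t + 1 => f (syncTraj f ξ t)

/-- The update set `U(t, η)`. -/
def updSet (η : C → ℕ → S) (t : ℕ) : Set C := {x | η x (t + 1) ≠ η x t}

open Classical in
/-- The effective age `τ(x, t, η)`: the number of `s < t` with `x ∈ U(s, η)`. -/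
noncomputable def effAge (η : C → ℕ → S) (x : C) (t : ℕ) : ℕ :=
  ((Finset.range t).filter fun s => η x (s + 1) ≠ η x s).card

/-- `f` has invariant histories. -/
def InvariantHistories (f : (C → S) → C → S) : Prop :=
  ∀ ξ : C → S, ∃ ζ : C → ℕ → S, ∀ η : C → ℕ → S,
    IsAsyncTraj f η → (∀ x, η x 0 = ξ x) → ∀ x t, η x t = ζ x (effAge η x t)

/-- `f` is monotonic: `L(t,η) \ U(t,η) ⊆ L(t+1,η)` for every asynchronous trajectory. -/
def Monotonic (f : (C → S) → C → S) : Prop :=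
  ∀ η : C → ℕ → S, IsAsyncTraj f η → ∀ t,
    freeSet f (fun x => η x t) \ updSet η t ⊆ freeSet f (fun x => η x (t + 1))

/-- `f` is commutative. -/
def CommutativeRule (f : (C → S) → C → S) : Prop :=
  ∀ (ξ : C → S) (A B : Set C), Disjoint A B →
    A ⊆ freeSet f ξ → B ⊆ freeSet f ξ →
    upd f (upd f ξ A) B = upd f ξ (A ∪ B)

/-- `f` is locally commutative. -/
def LocallyCommutative (f : (C → S) → C → S) : Prop :=
  ∀ (ξ : C → S) (x y : C), x ≠ y → x ∈ freeSet f ξ → y ∈ freeSet f ξ →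
    upd f (upd f ξ {x}) {y} = upd f ξ {x, y}

/-- `η₁` dominates `η₀` (they are assumed to have the same initial configuration). -/
def Dominates (η₁ η₀ : C → ℕ → S) : Prop :=
  (∀ x t, effAge η₀ x t ≤ effAge η₁ x t) ∧
  (∀ x t₀ t₁, effAge η₀ x t₀ = effAge η₁ x t₁ → η₀ x t₀ = η₁ x t₁)

open Classical in
theorem effAge_succ (η : C → ℕ → S) (x : C) (t : ℕ) :
    effAge η x (t + 1) = effAge η x t + if η x (t + 1) ≠ η x t then 1 else 0 := by
  unfold effAge
  rw [Finset.range_add_one, Finset.filter_insert]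
  split_ifs <;> simp

@[simp]
theorem effAge_zero (η : C → ℕ → S) (x : C) : effAge η x 0 = 0 := by
  simp [effAge]

open Classical in
theorem effAge_succ' (η : C → ℕ → S) (x : C) (t : ℕ) :
    effAge η x (t + 1) =
      (if η x 1 ≠ η x 0 then 1 else 0) + effAge (fun y s => η y (s + 1)) x t := by
  induction t with
  | zero => simp [effAge_succ]
  | succ t ih => rw [effAge_succ, ih, effAge_succ _ x t, add_assoc]

theorem eq_initial_of_effAge_eq_zero {η : C → ℕ → S} {x : C} {t : ℕ}
    (h : effAge η x t = 0) : η x t = η x 0 := by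
  induction t with
  | zero => rfl
  | succ t ih =>
    rw [effAge_succ] at h
    split_ifs at h with hx
    rw [not_not.mp hx, ih h]

/-- Updating some free sites does not change the transition at the other free sites. -/
theorem CommutativeRule.apply_upd {f : (C → S) → C → S} (hc : CommutativeRule f)
    {ξ : C → S} {A : Set C} (hA : A ⊆ freeSet f ξ) {x : C} (hx : x ∈ freeSet f ξ)
    (hxA : x ∉ A) : f (upd f ξ A) x = f ξ x := by
  have h := congrFun (hc ξ A {x} (by simpa using hxA) hA (by simpa using hx)) x
  simpa [upd] using h

theorem IsAsyncTraj.updSet_subset {f : (C → S) → C → S} {η : C → ℕ → S}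
    (hη : IsAsyncTraj f η) (t : ℕ) : updSet η t ⊆ freeSet f (fun y => η y t) := by
  intro x hx
  have h := hη x t hx
  simp only [updSet, freeSet, Set.mem_ofPred_eq] at hx ⊢
  rwa [← h]

theorem IsAsyncTraj.upd_updSet {f : (C → S) → C → S} {η : C → ℕ → S}
    (hη : IsAsyncTraj f η) (t : ℕ) :
    upd f (fun y => η y t) (updSet η t) = fun y => η y (t + 1) := by
  funext x
  by_cases hx : x ∈ updSet η t
  · simp [upd, hx, hη x t hx]
  · simp only [upd, hx, if_false]
    exact (not_not.mp hx).symm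

/-- A site that is initially free keeps its transition until it is first updated. -/
theorem IsAsyncTraj.apply_of_effAge_eq_zero {f : (C → S) → C → S} (hc : CommutativeRule f)
    {η : C → ℕ → S} (hη : IsAsyncTraj f η) {x : C}
    (hx : x ∈ freeSet f (fun y => η y 0)) {t : ℕ} (ht : effAge η x t = 0) :
    f (fun y => η y t) x = f (fun y => η y 0) x := by
  induction t with
  | zero => rfl
  | succ t ih =>
    rw [effAge_succ] at ht
    split_ifs at ht with hxt
    have h := ih ht
    have hfree : x ∈ freeSet f (fun y => η y t) := by
      simpa [freeSet, h, eq_initial_of_effAge_eq_zero ht] using hx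
    rw [← hη.upd_updSet t, hc.apply_upd (hη.updSet_subset t) hfree hxt, h]

/-- The initially free sites not updated before time `t`. -/
def pendingSet (f : (C → S) → C → S) (η : C → ℕ → S) (t : ℕ) : Set C :=
  {x | x ∈ freeSet f (fun y => η y 0) ∧ effAge η x t = 0}

theorem IsAsyncTraj.apply_of_mem_pendingSet {f : (C → S) → C → S} (hc : CommutativeRule f)
    {η : C → ℕ → S} (hη : IsAsyncTraj f η) {x : C} {t : ℕ} (hx : x ∈ pendingSet f η t) :
    f (fun y => η y t) x = f (fun y => η y 0) x :=
  hη.apply_of_effAge_eq_zero hc hx.1 hx.2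

theorem IsAsyncTraj.pendingSet_subset {f : (C → S) → C → S} (hc : CommutativeRule f)
    {η : C → ℕ → S} (hη : IsAsyncTraj f η) (t : ℕ) :
    pendingSet f η t ⊆ freeSet f (fun y => η y t) := by
  intro x hx
  simpa [freeSet, hη.apply_of_mem_pendingSet hc hx, eq_initial_of_effAge_eq_zero hx.2] using hx.1

theorem mem_pendingSet_succ {f : (C → S) → C → S} {η : C → ℕ → S} {x : C} {t : ℕ} :
    x ∈ pendingSet f η (t + 1) ↔ x ∈ pendingSet f η t ∧ η x (t + 1) = η x t := by
  simp +contextual [pendingSet, effAge_succ, and_assoc]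

/-- The trajectory `η` from time `1` on, with the first update of every initially free site
moved to time `0`. -/
noncomputable def advance (f : (C → S) → C → S) (η : C → ℕ → S) : C → ℕ → S :=
  fun x t => upd f (fun y => η y (t + 1)) (pendingSet f η (t + 1)) x

theorem advance_of_notMem {f : (C → S) → C → S} {η : C → ℕ → S} {x : C} {t : ℕ}
    (hx : x ∉ pendingSet f η (t + 1)) : advance f η x t = η x (t + 1) := by
  simp [advance, upd, hx]

theorem IsAsyncTraj.advance_of_mem {f : (C → S) → C → S} (hc : CommutativeRule f)
    {η : C → ℕ → S} (hη : IsAsyncTraj f η) {x : C} {t : ℕ}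
    (hx : x ∈ pendingSet f η (t + 1)) : advance f η x t = f (fun y => η y 0) x := by
  simp [advance, upd, hx, hη.apply_of_mem_pendingSet hc hx]

theorem IsAsyncTraj.advance_zero {f : (C → S) → C → S} (hc : CommutativeRule f)
    {η : C → ℕ → S} (hη : IsAsyncTraj f η) :
    (fun x => advance f η x 0) = f (fun y => η y 0) := by
  funext x
  by_cases hx : x ∈ pendingSet f η 1
  · exact hη.advance_of_mem hc hx
  · rw [advance_of_notMem hx]
    by_cases h : η x (0 + 1) = η x 0
    · have : f (fun y => η y 0) x = η x 0 := by
        simpa [mem_pendingSet_succ, pendingSet, freeSet, h] using mt mem_pendingSet_succ.mpr hx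
      rw [h, this]
    · exact hη x 0 h

theorem IsAsyncTraj.advance_succ_ne_iff {f : (C → S) → C → S} (hc : CommutativeRule f)
    {η : C → ℕ → S} (hη : IsAsyncTraj f η) (x : C) (t : ℕ) :
    advance f η x (t + 1) ≠ advance f η x t ↔
      η x (t + 2) ≠ η x (t + 1) ∧ x ∉ pendingSet f η (t + 1) := by
  by_cases hx : x ∈ pendingSet f η (t + 1)
  · have h : advance f η x (t + 1) = advance f η x t := by
      rw [hη.advance_of_mem hc hx]
      by_cases hx' : x ∈ pendingSet f η (t + 2)
      · exact hη.advance_of_mem hc hx'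
      · rw [advance_of_notMem hx', hη x (t + 1) fun h => hx' (mem_pendingSet_succ.mpr ⟨hx, h⟩),
          hη.apply_of_mem_pendingSet hc hx]
    simp [h, hx]
  · have hx' : x ∉ pendingSet f η (t + 2) := fun h => hx (mem_pendingSet_succ.mp h).1
    simp [advance_of_notMem hx, advance_of_notMem hx', hx]

theorem IsAsyncTraj.isAsyncTraj_advance {f : (C → S) → C → S} (hc : CommutativeRule f)
    {η : C → ℕ → S} (hη : IsAsyncTraj f η) : IsAsyncTraj f (advance f η) := by
  intro x t hx
  obtain ⟨h, hxA⟩ := (hη.advance_succ_ne_iff hc x t).mp hx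
  have hx' : x ∉ pendingSet f η (t + 2) := fun h => hxA (mem_pendingSet_succ.mp h).1
  rw [advance_of_notMem hx', hη x (t + 1) h]
  exact (hc.apply_upd (hη.pendingSet_subset hc (t + 1)) (hη.updSet_subset (t + 1) h) hxA).symm

open Classical in
theorem IsAsyncTraj.effAge_advance {f : (C → S) → C → S} (hc : CommutativeRule f)
    {η : C → ℕ → S} (hη : IsAsyncTraj f η) (x : C) (t : ℕ) :
    effAge η x (t + 1) + (if x ∈ pendingSet f η (t + 1) then 1 else 0) =
      (if x ∈ freeSet f (fun y => η y 0) then 1 else 0) + effAge (advance f η) x t := by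
  induction t with
  | zero =>
    have h (h0 : η x 1 ≠ η x 0) : x ∈ freeSet f (fun y => η y 0) := hη.updSet_subset 0 h0
    simp only [mem_pendingSet_succ, effAge_succ, effAge_zero]
    by_cases h0 : η x (0 + 1) = η x 0
    · simp [h0, pendingSet]
    · simp [h0, h h0]
  | succ t ih =>
    rw [effAge_succ, effAge_succ (advance f η), ← add_assoc, ← ih]
    simp only [hη.advance_succ_ne_iff hc, mem_pendingSet_succ (t := t + 1)]
    by_cases h : η x (t + 1 + 1) = η x (t + 1) <;>
      by_cases h' : x ∈ pendingSet f η (t + 1) <;> simp [h, h']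

theorem syncTraj_succ' (f : (C → S) → C → S) (ξ : C → S) (t : ℕ) :
    syncTraj f ξ (t + 1) = syncTraj f (f ξ) t := by
  induction t with
  | zero => rfl
  | succ t ih => rw [syncTraj, ih, syncTraj]

open Classical in
theorem effAge_syncTraj_succ (f : (C → S) → C → S) (ξ : C → S) (x : C) (t : ℕ) :
    effAge (fun y s => syncTraj f ξ s y) x (t + 1) =
      (if x ∈ freeSet f ξ then 1 else 0) + effAge (fun y s => syncTraj f (f ξ) s y) x t := by
  simp only [effAge_succ', syncTraj_succ']
  congr 1
  by_cases h : f ξ x = ξ x <;> simp [freeSet, syncTraj, h]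

theorem IsAsyncTraj.effAge_le_syncTraj {f : (C → S) → C → S} (hc : CommutativeRule f)
    {η : C → ℕ → S} (hη : IsAsyncTraj f η) (x : C) (t : ℕ) :
    effAge η x t ≤ effAge (fun y s => syncTraj f (fun z => η z 0) s y) x t := by
  induction t generalizing η with
  | zero => simp
  | succ t ih =>
    have h := ih (hη.isAsyncTraj_advance hc)
    simp only [hη.advance_zero hc] at h
    rw [effAge_syncTraj_succ]
    have := hη.effAge_advance hc x t
    omega

theorem IsAsyncTraj.eq_syncTraj {f : (C → S) → C → S} (hc : CommutativeRule f)
    {η : C → ℕ → S} (hη : IsAsyncTraj f η) {x : C} {t₀ t₁ : ℕ}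
    (h : effAge η x t₀ = effAge (fun y s => syncTraj f (fun z => η z 0) s y) x t₁) :
    η x t₀ = syncTraj f (fun z => η z 0) t₁ x := by
  induction t₁ generalizing η t₀ with
  | zero => exact eq_initial_of_effAge_eq_zero (by simpa using h)
  | succ t ih =>
    have key := @ih _ (hη.isAsyncTraj_advance hc)
    simp only [hη.advance_zero hc] at key
    rw [effAge_syncTraj_succ] at h
    rw [syncTraj_succ']
    cases t₀ with
    | zero =>
      have hx : x ∉ freeSet f (fun y => η y 0) := fun hx => by simp [hx] at h; omega
      have h' := key (t₀ := 0) (by simpa [hx] using h)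
      rw [congrFun (hη.advance_zero hc) x] at h'
      rw [← h']
      exact (not_not.mp hx).symm
    | succ s =>
      have hx : x ∉ pendingSet f η (s + 1) := fun hx => by simp [hx.1, hx.2] at h; omega
      rw [← advance_of_notMem hx]
      apply key
      have := hη.effAge_advance hc x s
      simp only [hx, if_false] at this
      omega

/-- Let (C, S, N, f) be an automaton with f commutative, and let η be an
asynchronous trajectory. Then the synchronous trajectory with initial configuration
η(·,0) dominates η. -/
theorem syncTraj_dominates
    {C S : Type*} (N : C → Set C) (f : (C → S) → C → S)
    (hf : IsTransition N f) (hc : CommutativeRule f)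
    (η : C → ℕ → S) (hη : IsAsyncTraj f η) :
    Dominates (fun x t => syncTraj f (fun y => η y 0) t x) η := by
  exact ⟨hη.effAge_le_syncTraj hc, fun _ _ _ => hη.eq_syncTraj hc⟩

end AsyncUpdating
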